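/- Let $A$ be an $F$-finite Noetherian equicodimensional domain of characteristic $p > 0$ with fraction field $K$, and let $A \subseteq R$ be a finite ring extension with $R$ equidimensional. Then for every $e > 0$, the function $\Spec(R) \to \mathbb{N}$, $\mathfrak{q} \mapsto [\kappa(\mathfrak{q})^{1/p^e}:\kappa(\mathfrak{q})] \cdot p^{e \dim(R_\mathfrak{q})}$, is constant with value $[K^{1/p^e}:K]$. -/

import Mathlib

open Module IsLocalRing

section Frob

/-- `F^e_* M`: the abelian group `M` with `R`-module structure restricted along the
`e`-th iterated Frobenius of `R`. -/
def FrobMod (p e : ℕ) (R M : Type*) : Type _ := M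

instance FrobMod.addCommGroup {p e : ℕ} {R M : Type*} [AddCommGroup M] :
    AddCommGroup (FrobMod p e R M) :=
  inferInstanceAs (AddCommGroup M)

noncomputable instance FrobMod.module {p e : ℕ} {R M : Type*} [CommRing R] [ExpChar R p]
    [AddCommGroup M] [Module R M] : Module R (FrobMod p e R M) :=
  Module.compHom M (iterateFrobenius R p e)

/-- `F^e_* B` (a.k.a. `B^{1/p^e}`) as a ring. -/
def FrobAlg (p e : ℕ) (B : Type*) : Type _ := B

instance FrobAlg.commRing {p e : ℕ} {B : Type*} [CommRing B] : CommRing (FrobAlg p e B) :=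
  inferInstanceAs (CommRing B)

/-- If `B` is an `A`-algebra, then `F^e_* B` is an `A`-algebra via `A → B` composed with
the `e`-th iterated Frobenius of `B`. -/
noncomputable instance FrobAlg.algebra {p e : ℕ} {A B : Type*} [CommRing A] [CommRing B]
    [Algebra A B] [ExpChar B p] : Algebra A (FrobAlg p e B) :=
  ((iterateFrobenius B p e).comp (algebraMap A B)).toAlgebra

/-- The `p`-degree `[k^{1/p^e} : k]` of a ring `k` of characteristic `p`. -/
noncomputable def pDeg (p e : ℕ) (k : Type*) [CommRing k] [ExpChar k p] : ℕ :=
  Module.finrank k (FrobAlg p e k)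

/-- The length of an `R`-module `M`, as the Krull dimension of its submodule lattice. -/
noncomputable def modLength (R M : Type*) [CommRing R] [AddCommGroup M] [Module R M] :
    WithBot ℕ∞ :=
  Order.krullDim (Submodule R M)

/-- The minimal number of generators of an `R`-module `M`. -/
noncomputable def minGens (R M : Type*) [CommRing R] [AddCommGroup M] [Module R M] : ℕ :=
  sInf {n : ℕ | ∃ s : Finset M, s.card = n ∧ Submodule.span R (s : Set M) = ⊤}

/-- The bracket power `I^{[p^e]}`. -/
noncomputable def bracketPow {R : Type*} [CommRing R] (p e : ℕ) [ExpChar R p] (I : Ideal R) :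
    Ideal R :=
  I.map (iterateFrobenius R p e)

end Frob

/-- Length of the cokernel of a composition of two linear maps, the second one injective. -/
theorem length_quotient_range_comp {A N M P : Type*} [CommRing A] [AddCommGroup N] [Module A N]
    [AddCommGroup M] [Module A M] [AddCommGroup P] [Module A P]
    (g : N →ₗ[A] M) (hg : Function.Injective g) (f : P →ₗ[A] N) :
    Module.length A (M ⧸ LinearMap.range (g ∘ₗ f)) =
      Module.length A (N ⧸ LinearMap.range f) + Module.length A (M ⧸ LinearMap.range g) := by
  have h₁ : LinearMap.range f ≤ (LinearMap.range (g ∘ₗ f)).comap g := by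
    rintro _ ⟨y, rfl⟩
    exact ⟨y, rfl⟩
  have h₂ : LinearMap.range (g ∘ₗ f) ≤ LinearMap.range g := LinearMap.range_comp_le_range f g
  refine Module.length_eq_add_of_exact
    (Submodule.mapQ (LinearMap.range f) (LinearMap.range (g ∘ₗ f)) g h₁)
    (Submodule.factor h₂) ?_ (Submodule.factor_surjective h₂) ?_
  · rw [← LinearMap.ker_eq_bot, LinearMap.ker_eq_bot']
    intro m hm
    obtain ⟨m, rfl⟩ := Submodule.mkQ_surjective _ m
    rw [Submodule.mkQ_apply, Submodule.mapQ_apply, Submodule.Quotient.mk_eq_zero] at hm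
    obtain ⟨y, hy⟩ := hm
    exact (Submodule.Quotient.mk_eq_zero _).mpr ⟨y, hg hy⟩
  · intro m
    obtain ⟨m, rfl⟩ := Submodule.mkQ_surjective _ m
    constructor
    · intro hm
      obtain ⟨n, rfl⟩ := (Submodule.Quotient.mk_eq_zero _).mp hm
      exact ⟨Submodule.Quotient.mk n, rfl⟩
    · rintro ⟨n, hn⟩
      obtain ⟨n, rfl⟩ := Submodule.mkQ_surjective _ n
      rw [← hn]
      exact (Submodule.Quotient.mk_eq_zero _).mpr ⟨n, rfl⟩

/-- A finite torsion module over a one-dimensional Noetherian ring has finite length. -/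
theorem Module.IsTorsion.length_ne_top {A T : Type*} [CommRing A] [IsNoetherianRing A]
    [Ring.KrullDimLE 1 A] [AddCommGroup T] [Module A T] [Module.Finite A T]
    (hT : Module.IsTorsion A T) : Module.length A T ≠ ⊤ := by
  obtain ⟨c, hc, hc₀⟩ := Submodule.annihilator_top_inter_nonZeroDivisors hT
  have hfl := isFiniteLength_iff_isNoetherian_isArtinian.mp
    (isFiniteLength_quotient_span_singleton A hc₀)
  have hart : IsArtinianRing (A ⧸ Ideal.span {c}) := isArtinian_of_tower A hfl.2
  have htor : Module.IsTorsionBySet A T (Ideal.span {c} : Ideal A) :=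
    (Module.isTorsionBySet_span_singleton_iff c).mpr
      fun x => Submodule.mem_annihilator.mp hc x Submodule.mem_top
  let _ : Module (A ⧸ Ideal.span {c}) T := htor.module
  have : IsScalarTower A (A ⧸ Ideal.span {c}) T := htor.isScalarTower
  have : Module.Finite (A ⧸ Ideal.span {c}) T := Module.Finite.of_restrictScalars_finite A _ T
  have : IsArtinian A T :=
    isArtinian_of_surjective_algebraMap (R := A ⧸ Ideal.span {c}) Ideal.Quotient.mk_surjective
  exact Module.length_ne_top

/-- Over a domain, a finite module contains a free submodule with torsion quotient. -/
theorem Module.exists_pi_injective_isTorsion_quotient_range (A M : Type*) [CommRing A] [IsDomain A]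
    [AddCommGroup M] [Module A M] [Module.Finite A M] :
    ∃ f : (Fin (finrank A M) → A) →ₗ[A] M, Function.Injective f ∧
      Module.IsTorsion A (M ⧸ LinearMap.range f) := by
  obtain ⟨v, hv⟩ := exists_linearIndependent_of_le_finrank (R := A) (M := M) le_rfl
  have hinj := hv.fintypeLinearCombination_injective
  refine ⟨Fintype.linearCombination A v, hinj, ?_⟩
  rw [← Module.finrank_eq_zero_iff_isTorsion, Submodule.finrank_quotient,
    LinearMap.finrank_range_of_inj hinj]
  simp

theorem length_pi_quotient_range_lsmul {A : Type*} [CommRing A] (n : ℕ) (x : A) :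
    Module.length A ((Fin n → A) ⧸ LinearMap.range (LinearMap.lsmul A (Fin n → A) x)) =
      n * Ring.ord A x := by
  have h : LinearMap.range (LinearMap.lsmul A (Fin n → A) x) =
      Submodule.pi Set.univ fun _ => Ideal.span {x} := by
    ext y
    simp only [LinearMap.mem_range, LinearMap.lsmul_apply, Submodule.mem_pi, Set.mem_univ,
      forall_const, Ideal.mem_span_singleton', mul_comm _ x]
    constructor
    · rintro ⟨z, rfl⟩ i
      exact ⟨z i, rfl⟩
    · intro hy
      choose z hz using hy
      exact ⟨z, funext hz⟩
  rw [h, (Submodule.quotientPi fun _ : Fin n => (Ideal.span {x} : Submodule A A)).length_eq,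
    Module.length_pi, ENat.card_eq_coe_fintype_card, Fintype.card_fin]
  rfl

/-- Over a one-dimensional Noetherian domain, `ℓ(M / x M) = rank M * ℓ(A / x A)` for a
finite torsion-free module `M` and `x ≠ 0`. -/
theorem length_quotient_range_lsmul {A M : Type*} [CommRing A] [IsDomain A] [IsNoetherianRing A]
    [Ring.KrullDimLE 1 A] [AddCommGroup M] [Module A M] [Module.Finite A M] {x : A}
    (hx : Function.Injective (LinearMap.lsmul A M x)) :
    Module.length A (M ⧸ LinearMap.range (LinearMap.lsmul A M x)) =
      finrank A M * Ring.ord A x := by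
  obtain ⟨f, hf, hT⟩ := Module.exists_pi_injective_isTorsion_quotient_range A M
  have h₁ := length_quotient_range_comp f hf (LinearMap.lsmul A _ x)
  have h₂ := length_quotient_range_comp (LinearMap.lsmul A M x) hx f
  have hcomm : f ∘ₗ LinearMap.lsmul A _ x = LinearMap.lsmul A M x ∘ₗ f := by
    ext; simp
  rw [hcomm, h₂, length_pi_quotient_range_lsmul, add_comm] at h₁
  exact ENat.add_left_injective_of_ne_top hT.length_ne_top h₁

section FrobeniusFinite

variable {p : ℕ} [hp : Fact p.Prime]

theorem CharP.of_ringHom {R S : Type*} [CommRing R] [CommRing S] [Nontrivial S] [CharP R p]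
    (f : R →+* S) : CharP S p :=
  (CharP.charP_iff_prime_eq_zero hp.out).mpr <| by
    rw [← map_natCast f, CharP.cast_eq_zero, map_zero]

/-- If the Frobenius endomorphism is finite then so are all its iterates. -/
theorem iterateFrobenius_finite_of_frobenius_finite {R : Type*} [CommRing R] [CharP R p]
    (h : (iterateFrobenius R p 1).Finite) (e : ℕ) : (iterateFrobenius R p e).Finite := by
  induction e with
  | zero =>
    rw [iterateFrobenius_zero]
    exact RingHom.Finite.id R
  | succ e ih =>
    rw [add_comm, iterateFrobenius_add]
    exact h.comp ih

theorem iterateFrobenius_finite_of_finite_ringHom {R S : Type*} [CommRing R] [CommRing S]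
    [CharP R p] [CharP S p] {e : ℕ} (h : (iterateFrobenius R p e).Finite) {f : R →+* S}
    (hf : f.Finite) : (iterateFrobenius S p e).Finite := by
  have := hf.comp h
  rw [RingHom.iterateFrobenius_comm] at this
  exact this.of_comp_finite

theorem iterateFrobenius_finite_of_isLocalization.{u} {R : Type u} [CommRing R] (M : Submonoid R)
    (S : Type u) [CommRing S] [Algebra R S] [IsLocalization M S] [CharP R p] [CharP S p] {e : ℕ}
    (h : (iterateFrobenius R p e).Finite) : (iterateFrobenius S p e).Finite := by
  have : IsLocalization (M.map (iterateFrobenius R p e)) S := by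
    refine (IsLocalization.iff_of_le_of_exists_dvd (S := S) _ M ?_ fun n hn => ?_).mpr inferInstance
    · rintro _ ⟨m, hm, rfl⟩
      exact pow_mem hm _
    · exact ⟨n ^ p ^ e, ⟨n, hn, rfl⟩, dvd_pow_self n (pow_ne_zero e hp.out.ne_zero)⟩
  convert RingHom.finite_localizationPreserves (iterateFrobenius R p e) M S S h
  refine IsLocalization.ringHom_ext M ?_
  rw [IsLocalization.map_comp, RingHom.iterateFrobenius_comm]

end FrobeniusFinite

/-- `[k^{1/p^e} : k]` may be computed using any ring in place of `k^{1/p^e}`. -/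
theorem pDeg_eq_finrank {p e : ℕ} {k l : Type*} [CommRing k] [CommRing l] [ExpChar k p]
    [Algebra k l] (j : k ≃+* l) (hj : ∀ x, algebraMap k l x = j (x ^ p ^ e)) :
    pDeg p e k = finrank k l :=
  Algebra.finrank_eq_of_equiv_equiv (S₀ := FrobAlg p e k) (RingEquiv.refl k) j (RingHom.ext hj)

theorem pDeg_congr {p e : ℕ} {k l : Type*} [CommRing k] [CommRing l] [ExpChar k p]
    [ExpChar l p] (j : k ≃+* l) : pDeg p e k = pDeg p e l :=
  Algebra.finrank_eq_of_equiv_equiv (S₀ := FrobAlg p e k) (S₁ := FrobAlg p e l) j j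
    (RingHom.ext fun x => (map_pow j x (p ^ e)).symm)

theorem Ring.ord_ringEquiv {A B : Type*} [CommRing A] [CommRing B] (j : A ≃+* B) (x : A) :
    Ring.ord B (j x) = Ring.ord A x := by
  let _ : Algebra A B := j.toRingHom.toAlgebra
  have hj : Ideal.span {j x} = (Ideal.span {x}).map (j : A →+* B) := by
    rw [Ideal.map_span, Set.image_singleton, RingHom.coe_coe]
  rw [Ring.ord, Ring.ord, ← Module.length_eq_of_surjective (S := A) (R := B) j.surjective]
  exact (Ideal.quotientEquivAlg _ _
    (AlgEquiv.ofRingEquiv (R := A) (f := j) fun _ => rfl) hj).toLinearEquiv.length_eq.symm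

/-- The degree `[K^{1/p^e} : K]` for the fraction field `K` of a domain `A` is the rank of
`F^e_* A`. -/
theorem pDeg_eq_finrank_of_isFractionRing {p e : ℕ} {A B K : Type*} [CommRing A] [CommRing B]
    [Algebra A B] [Field K] [Algebra A K] [IsFractionRing A K] [ExpChar K p] (j : A ≃+* B)
    (hj : ∀ x, algebraMap A B x = j (x ^ p ^ e)) : pDeg p e K = finrank A B := by
  let L := FrobAlg p e K
  let i : K ≃+* L := RingEquiv.refl K
  have hi : ∀ x, algebraMap A L x = i (algebraMap A K x ^ p ^ e) := fun _ => rfl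
  have hi' : ∀ x, algebraMap K L x = i (x ^ p ^ e) := fun _ => rfl
  clear_value i
  let _ : Algebra B L := ((i : K →+* L).comp ((algebraMap A K).comp j.symm)).toAlgebra
  have hB : ∀ x, algebraMap B L x = i (algebraMap A K (j.symm x)) := fun _ => rfl
  have : IsScalarTower A K L := .of_algebraMap_eq fun x => by rw [hi, hi']
  have : IsScalarTower A B L := .of_algebraMap_eq fun x => by
    rw [hi, hj, hB, j.symm_apply_apply, map_pow (algebraMap A K)]
  have : IsFractionRing B L := by
    let _ : Algebra B K := ((algebraMap A K).comp j.symm).toAlgebra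
    have : IsFractionRing B K :=
      (IsFractionRing.isFractionRing_iff_of_base_ringEquiv K j).mp inferInstance
    exact IsLocalization.isLocalization_of_algEquiv _
      (AlgEquiv.ofRingEquiv (R := B) (f := i) fun x => rfl)
  exact IsFractionRing.finrank_eq A K B L

/-- Let `(A, 𝔪, k)` be a one-dimensional `F`-finite local domain with fraction field `K`. Then
`[k^{1/p^e} : k] * p^e = [K^{1/p^e} : K]`. -/
theorem pDeg_residueField_mul_pow {p e : ℕ} [hp : Fact p.Prime] (A K : Type*) [CommRing A]
    [IsDomain A] [IsLocalRing A] [IsNoetherianRing A] [Ring.KrullDimLE 1 A] (hA : ¬ IsField A)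
    [Field K] [Algebra A K] [IsFractionRing A K] [CharP A p] [ExpChar (ResidueField A) p]
    [ExpChar K p] (hfin : (iterateFrobenius A p e).Finite) :
    pDeg p e (ResidueField A) * p ^ e = pDeg p e K := by
  have hq : p ^ e ≠ 0 := pow_ne_zero e hp.out.ne_zero
  let B := FrobAlg p e A
  let j : A ≃+* B := RingEquiv.refl A
  have hj : ∀ x, algebraMap A B x = j (x ^ p ^ e) := fun _ => rfl
  clear_value j
  have : IsDomain B := MulEquiv.isDomain A j.symm.toMulEquiv
  have : IsLocalRing B := j.isLocalRing
  have : Module.Finite A B := hfin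
  have hlocal : IsLocalHom (algebraMap A B) := ⟨fun x hx => by
    rw [hj, MulEquiv.isUnit_map] at hx
    exact (isUnit_pow_iff hq).mp hx⟩
  have hpk : pDeg p e (ResidueField A) = finrank (ResidueField A) (ResidueField B) := by
    refine pDeg_eq_finrank (ResidueField.mapEquiv j) fun x => ?_
    obtain ⟨x, rfl⟩ := residue_surjective x
    rw [ResidueField.algebraMap_residue, hj, ← map_pow]
    rfl
  have hpK : pDeg p e K = finrank A B := pDeg_eq_finrank_of_isFractionRing j hj
  obtain ⟨x, hx, hx₀⟩ : ∃ x ∈ maximalIdeal A, x ≠ 0 := by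
    by_contra! h
    exact hA (isField_iff_maximalIdeal_eq.mpr ((Submodule.eq_bot_iff _).mpr h))
  have hBx : algebraMap A B x ≠ 0 := by
    rw [hj]
    exact (map_ne_zero_iff j j.injective).mpr (pow_ne_zero _ hx₀)
  have hord₀ : Ring.ord A x ≠ 0 := by
    rw [Ring.ord, Ne, Module.length_eq_zero_iff, Ideal.Quotient.subsingleton_iff,
      Ideal.span_singleton_eq_top]
    exact (mem_maximalIdeal x).mp hx
  have hord : Ring.ord A x ≠ ⊤ := Ring.ord_ne_top (mem_nonZeroDivisors_of_ne_zero hx₀)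
  have hlB : Module.length B (B ⧸ Ideal.span {algebraMap A B x}) =
      (p ^ e : ℕ) * Ring.ord A x := by
    rw [hj, ← Ring.ord, Ring.ord_ringEquiv, Ring.ord_pow (mem_nonZeroDivisors_of_ne_zero hx₀),
      nsmul_eq_mul]
  have hrange : LinearMap.range (LinearMap.lsmul A B x) =
      (Ideal.span {algebraMap A B x}).restrictScalars A := by
    ext y
    simp [Ideal.mem_span_singleton', Algebra.smul_def, mul_comm]
  have h₁ := length_quotient_range_lsmul (A := A) (M := B) (x := x) fun y z hyz => by
    simpa [Algebra.smul_def, hBx] using hyz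
  have h₂ := IsLocalRing.length_restrictScalars A B (B ⧸ Ideal.span {algebraMap A B x})
  have h₃ : Module.length A (B ⧸ Ideal.span {algebraMap A B x}) =
      Module.length A (B ⧸ LinearMap.range (LinearMap.lsmul A B x)) := by
    rw [hrange]
    exact (Submodule.Quotient.restrictScalarsEquiv A (Ideal.span {algebraMap A B x})).length_eq.symm
  rw [h₃, h₁, hlB, Module.length_eq_finrank, ← hpk, ← hpK] at h₂
  lift Ring.ord A x to ℕ using hord with n
  norm_cast at h₂ hord₀
  refine Nat.eq_of_mul_eq_mul_right (Nat.pos_of_ne_zero hord₀) ?_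
  rw [h₂]
  ring

theorem Ring.KrullDimLE.of_isLocalization_atPrime {D : Type*} [CommRing D] [IsDomain D]
    (q : Ideal D) [q.IsPrime] (hq : ∀ I : Ideal D, I.IsPrime → I ≠ ⊥ → I ≤ q → I = q) (A : Type*)
    [CommRing A] [Algebra D A] [IsLocalization.AtPrime A q] : Ring.KrullDimLE 1 A := by
  have hS : q.primeCompl ≤ nonZeroDivisors D := Ideal.primeCompl_le_nonZeroDivisors q
  have : IsDomain A := IsLocalization.isDomain_of_le_nonZeroDivisors (M := q.primeCompl) A hS
  have : IsLocalRing A := IsLocalization.AtPrime.isLocalRing A q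
  refine .mk₁' fun I hI₀ hI => ?_
  have h : I.under D = q := by
    refine hq _ inferInstance ?_ ?_
    · intro h
      rw [← IsLocalization.map_under q.primeCompl A I, h, Ideal.map_bot] at hI₀
      exact hI₀ rfl
    · rw [← IsLocalization.AtPrime.under_maximalIdeal A q]
      exact Ideal.comap_mono (le_maximalIdeal hI.ne_top)
  rw [← IsLocalization.map_under q.primeCompl A I, h,
    ← IsLocalization.AtPrime.under_maximalIdeal A q, IsLocalization.map_under q.primeCompl A]
  infer_instance

/-- If `q` is a prime of height one of an `F`-finite domain `D` with fraction field `K`, then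
`[κ(q)^{1/p^e} : κ(q)] * p^e = [K^{1/p^e} : K]`. -/
theorem pDeg_residueField_localization_mul_pow.{u} {p e : ℕ} [hp : Fact p.Prime] {D : Type u}
    [CommRing D]
    [IsDomain D] [IsNoetherianRing D] [CharP D p] (hfin : (iterateFrobenius D p e).Finite)
    (q : Ideal D) [q.IsPrime] (hq₀ : q ≠ ⊥)
    (hq : ∀ I : Ideal D, I.IsPrime → I ≠ ⊥ → I ≤ q → I = q)
    (A : Type u) [CommRing A] [Algebra D A] [IsLocalRing A] [IsLocalization.AtPrime A q]
    (K : Type*) [Field K] [Algebra D K] [IsFractionRing D K] [ExpChar K p]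
    [ExpChar (ResidueField A) p] : pDeg p e (ResidueField A) * p ^ e = pDeg p e K := by
  have hS : q.primeCompl ≤ nonZeroDivisors D := Ideal.primeCompl_le_nonZeroDivisors q
  have : IsDomain A := IsLocalization.isDomain_of_le_nonZeroDivisors (M := q.primeCompl) A hS
  have : IsNoetherianRing A := IsLocalization.isNoetherianRing q.primeCompl A inferInstance
  have hA : CharP A p := CharP.of_ringHom (algebraMap D A)
  have := Ring.KrullDimLE.of_isLocalization_atPrime q hq A
  have hfield : ¬ IsField A := IsLocalization.AtPrime.not_isField D hq₀ A
  let _ : Algebra A K :=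
    (Localization.mapToFractionRing K q.primeCompl A hS).toRingHom.toAlgebra
  have : IsScalarTower D A K := .of_algebraMap_eq fun x =>
    ((Localization.mapToFractionRing K q.primeCompl A hS).commutes x).symm
  have : IsFractionRing A K :=
    IsFractionRing.isFractionRing_of_isDomain_of_isLocalization q.primeCompl A _
  exact pDeg_residueField_mul_pow A K hfield
    (iterateFrobenius_finite_of_isLocalization q.primeCompl A hfin)

/-- If `P ⋖ Q` are primes of an `F`-finite ring, then `[κ(Q)^{1/p^e} : κ(Q)] * p^e` equals
`[κ(P)^{1/p^e} : κ(P)]`. -/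
theorem pDeg_mul_pow_of_covBy {p e : ℕ} [hp : Fact p.Prime] {R : Type*} [CommRing R]
    [IsNoetherianRing R] [CharP R p] (hfin : (iterateFrobenius R p e).Finite)
    {P Q : PrimeSpectrum R} (hPQ : P ⋖ Q) [ExpChar (FractionRing (R ⧸ P.asIdeal)) p]
    [ExpChar (FractionRing (R ⧸ Q.asIdeal)) p] :
    pDeg p e (FractionRing (R ⧸ Q.asIdeal)) * p ^ e = pDeg p e (FractionRing (R ⧸ P.asIdeal)) := by
  have hle : P.asIdeal ≤ Q.asIdeal := hPQ.le
  have hπ : Function.Surjective (Ideal.Quotient.mk P.asIdeal) := Ideal.Quotient.mk_surjective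
  have hker : RingHom.ker (Ideal.Quotient.mk P.asIdeal) = P.asIdeal := Ideal.mk_ker
  have hcomap : (Q.asIdeal.map (Ideal.Quotient.mk P.asIdeal)).comap (Ideal.Quotient.mk P.asIdeal)
      = Q.asIdeal := by rw [Ideal.comap_map_of_surjective' _ hπ, hker, sup_eq_left.mpr hle]
  have hq : (Q.asIdeal.map (Ideal.Quotient.mk P.asIdeal)).IsPrime :=
    Ideal.map_isPrime_of_surjective hπ (hker.trans_le hle)
  have hD : CharP (R ⧸ P.asIdeal) p := CharP.of_ringHom (Ideal.Quotient.mk P.asIdeal)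
  have hk : CharP (Q.asIdeal.map (Ideal.Quotient.mk P.asIdeal)).ResidueField p :=
    CharP.of_ringHom (algebraMap (R ⧸ P.asIdeal) _)
  rw [← pDeg_residueField_localization_mul_pow (K := FractionRing (R ⧸ P.asIdeal))
    (iterateFrobenius_finite_of_finite_ringHom hfin (RingHom.Finite.of_surjective _ hπ))
    (Q.asIdeal.map (Ideal.Quotient.mk P.asIdeal)) ?_ ?_
    (Localization.AtPrime (Q.asIdeal.map (Ideal.Quotient.mk P.asIdeal)))]
  · congr 1
    exact pDeg_congr (IsFractionRing.ringEquivOfRingEquiv (K := FractionRing (R ⧸ Q.asIdeal))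
      (L := (Q.asIdeal.map (Ideal.Quotient.mk P.asIdeal)).ResidueField)
      (DoubleQuot.quotQuotEquivQuotOfLE hle).symm)
  · intro h
    rw [h, ← RingHom.ker, hker] at hcomap
    exact hPQ.ne (PrimeSpectrum.ext hcomap)
  · intro I hI hI₀ hIq
    let J : PrimeSpectrum R := PrimeSpectrum.comap (Ideal.Quotient.mk P.asIdeal) ⟨I, hI⟩
    have hJ : J.asIdeal = I.comap (Ideal.Quotient.mk P.asIdeal) := rfl
    have hPJ : P ≤ J := by
      rw [← PrimeSpectrum.asIdeal_le_asIdeal, ← hker]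
      exact Ideal.comap_mono bot_le
    have hJQ : J ≤ Q := by
      rw [← PrimeSpectrum.asIdeal_le_asIdeal, ← hcomap]
      exact Ideal.comap_mono hIq
    rcases hPQ.eq_or_eq hPJ hJQ with h | h
    · refine absurd (Ideal.comap_injective_of_surjective _ hπ ?_) hI₀
      rw [← hJ, h, ← RingHom.ker, hker]
    · refine Ideal.comap_injective_of_surjective _ hπ ?_
      rw [hcomap, ← hJ, h]

theorem pDeg_ne_zero {p e : ℕ} {K : Type*} [Field K] [ExpChar K p]
    (h : (iterateFrobenius K p e).Finite) : pDeg p e K ≠ 0 := by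
  have : Module.Finite K (FrobAlg p e K) := h
  have : Nontrivial (FrobAlg p e K) := inferInstanceAs (Nontrivial K)
  exact finrank_pos.ne'

/-- For every prime `Q` of an `F`-finite ring there is a minimal prime `P ≤ Q` with
`[κ(Q)^{1/p^e} : κ(Q)] * p^{e * height Q} = [κ(P)^{1/p^e} : κ(P)]`. -/
theorem exists_isMin_pDeg_mul_pow_eq {p e : ℕ} [hp : Fact p.Prime] {R : Type*} [CommRing R]
    [IsNoetherianRing R] [CharP R p] (hfin : (iterateFrobenius R p e).Finite) (n : ℕ)
    (Q : PrimeSpectrum R) (hQ : Order.height Q = n) [ExpChar (FractionRing (R ⧸ Q.asIdeal)) p] :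
    ∃ P ≤ Q, IsMin P ∧ ∀ [ExpChar (FractionRing (R ⧸ P.asIdeal)) p],
      pDeg p e (FractionRing (R ⧸ Q.asIdeal)) * p ^ (e * n) =
        pDeg p e (FractionRing (R ⧸ P.asIdeal)) := by
  induction n generalizing Q with
  | zero =>
    refine ⟨Q, le_rfl, Order.height_eq_zero.mp hQ, fun {_} => ?_⟩
    simp
  | succ n ih =>
    obtain ⟨-, ⟨P, hPQ, hP⟩, hle⟩ := Order.height_eq_coe_add_one_iff.mp hQ
    have hcov : P ⋖ Q := ⟨hPQ, fun J hPJ hJQ => by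
      have := Order.height_strictMono hPJ (hP.trans_lt (ENat.natCast_lt_top n))
      rw [hP] at this
      exact this.not_ge (hle J hJQ)⟩
    have hchar : CharP (FractionRing (R ⧸ P.asIdeal)) p :=
      CharP.of_ringHom ((algebraMap (R ⧸ P.asIdeal) _).comp (Ideal.Quotient.mk P.asIdeal))
    obtain ⟨P₀, hP₀, hmin, h⟩ := ih P hP
    refine ⟨P₀, hP₀.trans hPQ.le, hmin, fun {_} => ?_⟩
    rw [← h, ← pDeg_mul_pow_of_covBy hfin hcov]
    ring

/-- An `F`-finite Noetherian domain has finite Krull dimension. -/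
theorem ringKrullDim_lt_top_of_iterateFrobenius_finite {p : ℕ} [hp : Fact p.Prime] {A : Type*}
    [CommRing A] [IsDomain A] [IsNoetherianRing A] [CharP A p]
    (hfin : (iterateFrobenius A p 1).Finite) : ringKrullDim A < ⊤ := by
  have hcharP : ∀ P : PrimeSpectrum A, CharP (FractionRing (A ⧸ P.asIdeal)) p := fun P =>
    CharP.of_ringHom ((algebraMap (A ⧸ P.asIdeal) _).comp (Ideal.Quotient.mk P.asIdeal))
  have := hcharP ⊥
  have hK : pDeg p 1 (FractionRing (A ⧸ (⊥ : PrimeSpectrum A).asIdeal)) ≠ 0 := by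
    have : CharP (A ⧸ (⊥ : PrimeSpectrum A).asIdeal) p := CharP.of_ringHom (Ideal.Quotient.mk _)
    have h₁ : (iterateFrobenius (A ⧸ (⊥ : PrimeSpectrum A).asIdeal) p 1).Finite :=
      iterateFrobenius_finite_of_finite_ringHom hfin
        (RingHom.Finite.of_surjective _ Ideal.Quotient.mk_surjective)
    exact pDeg_ne_zero (iterateFrobenius_finite_of_isLocalization (nonZeroDivisors _) _ h₁)
  refine lt_of_le_of_lt (b := ((pDeg p 1
    (FractionRing (A ⧸ (⊥ : PrimeSpectrum A).asIdeal)) : ℕ∞) : WithBot ℕ∞)) ?_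
      (WithBot.coe_lt_coe.mpr (ENat.natCast_lt_top _))
  rw [ringKrullDim_le_iff_height_le]
  intro P hP
  obtain ⟨n, hn⟩ := ENat.ne_top_iff_exists.mp (Ideal.height_ne_top hP.ne_top)
  have h := PrimeSpectrum.height_eq_orderHeight ⟨P, hP⟩
  have := hcharP ⟨P, hP⟩
  obtain ⟨P₀, -, hmin, hP₀⟩ := exists_isMin_pDeg_mul_pow_eq hfin n ⟨P, hP⟩ (h.symm.trans hn.symm)
  obtain rfl := hmin.eq_bot
  rw [← hn]
  refine WithBot.coe_le_coe.mpr (Nat.cast_le.mpr ?_)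
  refine (Nat.lt_pow_self hp.out.one_lt).le.trans (Nat.le_of_dvd (Nat.pos_of_ne_zero hK) ?_)
  rw [← hP₀, one_mul]
  exact dvd_mul_left _ _

/-- An integral extension does not have smaller Krull dimension than the base. -/
theorem ringKrullDim_le_of_isIntegral_of_injective {A R : Type*} [CommRing A] [CommRing R]
    [IsNoetherianRing A] [Algebra A R] [Algebra.IsIntegral A R]
    (hinj : Function.Injective (algebraMap A R)) : ringKrullDim A ≤ ringKrullDim R := by
  have key : ∀ (n : ℕ) (P : PrimeSpectrum A), Order.height P = n →
      ∃ Q : PrimeSpectrum R, PrimeSpectrum.comap (algebraMap A R) Q = P ∧ n ≤ Order.height Q := by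
    intro n
    induction n with
    | zero =>
      intro P _
      obtain ⟨Q, -, hQ, h⟩ := Ideal.exists_ideal_over_prime_of_isIntegral P.asIdeal (⊥ : Ideal R)
        ((Ideal.comap_bot_of_injective _ hinj).trans_le bot_le)
      exact ⟨⟨Q, hQ⟩, PrimeSpectrum.ext h, by simp⟩
    | succ n ih =>
      intro P hP
      obtain ⟨-, ⟨P', hlt, hP'⟩, -⟩ := Order.height_eq_coe_add_one_iff.mp hP
      obtain ⟨Q', hQ', hn⟩ := ih P' hP'
      obtain ⟨Q, hle, hQ, h⟩ := Ideal.exists_ideal_over_prime_of_isIntegral P.asIdeal Q'.asIdeal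
        ((congrArg PrimeSpectrum.asIdeal hQ').trans_le hlt.le)
      have hPQ : PrimeSpectrum.comap (algebraMap A R) ⟨Q, hQ⟩ = P := PrimeSpectrum.ext h
      refine ⟨⟨Q, hQ⟩, hPQ, ?_⟩
      have hlt' : Q' < ⟨Q, hQ⟩ := lt_of_le_of_ne hle fun heq => by
        rw [← hPQ, ← hQ', heq] at hlt
        exact hlt.false
      push_cast
      exact (add_le_add_left hn 1).trans (Order.height_add_one_le hlt')
  rw [ringKrullDim_le_iff_height_le]
  intro P hP
  obtain ⟨n, hn⟩ := ENat.ne_top_iff_exists.mp (Ideal.height_ne_top hP.ne_top)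
  have h := PrimeSpectrum.height_eq_orderHeight ⟨P, hP⟩
  obtain ⟨Q, -, hQ⟩ := key n ⟨P, hP⟩ (h.symm.trans hn.symm)
  rw [← hn]
  exact (WithBot.coe_le_coe.mpr hQ).trans (Order.height_le_krullDim Q)

theorem ringKrullDim_le_of_isIntegral (A R : Type*) [CommRing A] [CommRing R] [Algebra A R]
    [Algebra.IsIntegral A R] : ringKrullDim R ≤ ringKrullDim A :=
  Order.krullDim_le_of_strictMono (PrimeSpectrum.comap (algebraMap A R)) fun _ _ hPQ =>
    Ideal.IsIntegral.comap_lt_comap hPQ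

theorem under_eq_bot_of_ringKrullDim_quotient_eq {A R : Type*} [CommRing A] [IsDomain A]
    [IsNoetherianRing A] [CommRing R] [Algebra A R] [Algebra.IsIntegral A R]
    (hinj : Function.Injective (algebraMap A R)) (hA : ringKrullDim A < ⊤) (P : Ideal R) [P.IsPrime]
    (hP : ringKrullDim (R ⧸ P) = ringKrullDim R) : P.under A = ⊥ := by
  by_contra h
  obtain ⟨x, hx, hx₀⟩ := Submodule.exists_mem_ne_zero_of_ne_bot h
  have h₁ := ringKrullDim_succ_le_of_surjective (Ideal.Quotient.mk (P.under A))
    Ideal.Quotient.mk_surjective (mem_nonZeroDivisors_of_ne_zero hx₀)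
    (Ideal.Quotient.eq_zero_iff_mem.mpr hx)
  have h₂ := ringKrullDim_le_of_isIntegral_of_injective hinj
  have h₃ := ringKrullDim_le_of_isIntegral (A ⧸ P.under A) (R ⧸ P)
  have h₄ : ringKrullDim A + 1 ≤ ringKrullDim A := by
    refine le_trans ?_ h₁
    gcongr
    exact h₂.trans (hP.symm.trans_le h₃)
  obtain ⟨n, hn⟩ : ∃ n : ℕ, ringKrullDim A = n := by
    obtain ⟨d, hd⟩ := WithBot.ne_bot_iff_exists.mp
      (Order.bot_lt_krullDim (α := PrimeSpectrum A)).ne'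
    change d = ringKrullDim A at hd
    rw [← hd] at hA ⊢
    obtain ⟨n, hn⟩ := ENat.ne_top_iff_exists.mp (WithBot.coe_lt_coe.mp hA).ne
    exact ⟨n, by rw [← hn]; rfl⟩
  rw [hn] at h₄
  norm_cast at h₄
  omega

/-- The degree `[K^{1/p^e} : K]` is invariant under finite field extensions. -/
theorem pDeg_eq_of_finiteDimensional {p e : ℕ} (K L : Type*) [Field K] [Field L] [Algebra K L]
    [FiniteDimensional K L] [ExpChar K p] [ExpChar L p] : pDeg p e L = pDeg p e K := by
  let K' := FrobAlg p e K
  let L' := FrobAlg p e L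
  let i : K ≃+* K' := RingEquiv.refl K
  let j : L ≃+* L' := RingEquiv.refl L
  have hi : ∀ x, algebraMap K K' x = i (x ^ p ^ e) := fun _ => rfl
  have hj : ∀ x, algebraMap L L' x = j (x ^ p ^ e) := fun _ => rfl
  have hj' : ∀ x, algebraMap K L' x = j (algebraMap K L x ^ p ^ e) := fun _ => rfl
  clear_value i j
  have : IsDomain K' := MulEquiv.isDomain K i.symm.toMulEquiv
  have : IsDomain L' := MulEquiv.isDomain L j.symm.toMulEquiv
  let _ : Algebra K' L' := ((j : L →+* L').comp ((algebraMap K L).comp i.symm)).toAlgebra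
  have hij : ∀ x, algebraMap K' L' x = j (algebraMap K L (i.symm x)) := fun _ => rfl
  have : FaithfulSMul K' L' := (faithfulSMul_iff_algebraMap_injective K' L').mpr <|
    j.injective.comp ((algebraMap K L).injective.comp i.symm.injective)
  have : IsScalarTower K L L' := .of_algebraMap_eq fun _ => by rw [hj, hj']
  have : IsScalarTower K K' L' := .of_algebraMap_eq fun x => by
    rw [hi, hij, hj', i.symm_apply_apply, map_pow (algebraMap K L)]
  have h₁ : finrank K L * finrank L L' = finrank K L' := Module.finrank_mul_finrank K L L'
  have h₂ : finrank K K' * finrank K' L' = finrank K L' := Module.finrank_mul_finrank' L'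
  have h₃ : finrank K L = finrank K' L' :=
    Algebra.finrank_eq_of_equiv_equiv i j (RingHom.ext fun x => by
      change algebraMap K' L' (i x) = j (algebraMap K L x)
      rw [hij, i.symm_apply_apply])
  have h₄ : 0 < finrank K L := finrank_pos
  refine Nat.eq_of_mul_eq_mul_left h₄ (h₁.trans ?_)
  rw [← h₂, ← h₃, mul_comm]
  rfl

/-- Let `A` be an `F`-finite Noetherian equicodimensional domain of characteristic `p > 0`
with fraction field `K`, and `A ⊆ R` a finite extension with `R` equidimensional.  Then
for every `e > 0`, the function `𝔮 ↦ [κ(𝔮)^{1/p^e}:κ(𝔮)] ⬝ p^{e dim R_𝔮}` on `Spec R` is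
constant with value `[K^{1/p^e}:K]`. -/
theorem stmt18 (p : ℕ) [Fact p.Prime] (A R : Type*) [CommRing A] [CommRing R]
    [IsNoetherianRing A] [IsDomain A] [CharP A p] [CharP R p]
    [Module.Finite A (FrobAlg p 1 A)]
    (hequicodim : ∀ m : PrimeSpectrum A, m.asIdeal.IsMaximal →
      ringKrullDim (Localization.AtPrime m.asIdeal) = ringKrullDim A)
    [Algebra A R] [Module.Finite A R]
    (hinj : Function.Injective (algebraMap A R))
    (hequidim : ∀ P ∈ minimalPrimes R, ringKrullDim (R ⧸ P) = ringKrullDim R)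
    [CharP (FractionRing A) p]
    (e : ℕ) (he : 0 < e)
    (q : PrimeSpectrum R) [CharP (FractionRing (R ⧸ q.asIdeal)) p]
    (h : ℕ) (hh : ringKrullDim (Localization.AtPrime q.asIdeal) = h) :
    pDeg p e (FractionRing (R ⧸ q.asIdeal)) * p ^ (e * h) =
      pDeg p e (FractionRing A) := by
  have hA : (iterateFrobenius A p 1).Finite := ‹Module.Finite A (FrobAlg p 1 A)›
  have hR : (iterateFrobenius R p e).Finite :=
    iterateFrobenius_finite_of_finite_ringHom (iterateFrobenius_finite_of_frobenius_finite hA e)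
      (RingHom.finite_algebraMap.mpr ‹Module.Finite A R›)
  have : IsNoetherianRing R := IsNoetherianRing.of_finite A R
  have hq : Order.height q = h := by
    rw [IsLocalization.AtPrime.ringKrullDim_eq_height q.asIdeal,
      PrimeSpectrum.height_eq_orderHeight] at hh
    exact WithBot.coe_injective hh
  obtain ⟨P, -, hmin, hP⟩ := exists_isMin_pDeg_mul_pow_eq hR h q hq
  have : CharP (FractionRing (R ⧸ P.asIdeal)) p :=
    CharP.of_ringHom ((algebraMap (R ⧸ P.asIdeal) _).comp (Ideal.Quotient.mk P.asIdeal))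
  have hbot : P.asIdeal.under A = ⊥ :=
    under_eq_bot_of_ringKrullDim_quotient_eq hinj
      (ringKrullDim_lt_top_of_iterateFrobenius_finite hA) P.asIdeal
      (hequidim _ (PrimeSpectrum.isMin_iff.mp hmin))
  have : FaithfulSMul A (R ⧸ P.asIdeal) := by
    rw [faithfulSMul_iff_algebraMap_injective, injective_iff_map_eq_zero]
    intro x hx
    have hx' : x ∈ P.asIdeal.under A :=
      (Ideal.Quotient.eq_zero_iff_mem (I := P.asIdeal) (a := algebraMap A R x)).mp hx
    rwa [hbot] at hx'
  let _ := FractionRing.liftAlgebra A (FractionRing (R ⧸ P.asIdeal))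
  rw [hP]
  exact pDeg_eq_of_finiteDimensional (FractionRing A) (FractionRing (R ⧸ P.asIdeal))
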